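/- ∫₀^∞ ( π⁵ e^{-π³x²/G} + G^{5/2} e^{-Gx²/π} ) x²/cosh(πx) dx = (π G^{3/2}/2) ∫₀^∞ e^{-Gx²/π}/cosh(πx) dx, where G is Catalan's constant. -/

import Mathlib

open Real MeasureTheory
open scoped FourierTransform

lemma integrable_inv_cosh_pi_mul : Integrable fun x : ℝ => 1 / cosh (π * x) := by
  refine integrable_inv_one_add_sq.mono' (Measurable.aestronglyMeasurable (by fun_prop))
    (ae_of_all _ fun x => ?_)
  rw [norm_of_nonneg (by positivity), one_div]
  have h : cosh (π * x) = 1 + 2 * sinh (π * x / 2) ^ 2 := by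
    rw [show π * x = 2 * (π * x / 2) by ring, cosh_two_mul, cosh_sq]; ring_nf
  have h2 : (π * x / 2) ^ 2 ≤ sinh (π * x / 2) ^ 2 := by
    rw [sq_le_sq, abs_sinh]
    exact self_le_sinh_iff.2 (abs_nonneg _)
  have h3 := pi_gt_three
  refine inv_anti₀ (by positivity) ?_
  rw [h]
  nlinarith [mul_nonneg (by nlinarith : 0 ≤ π ^ 2 - 2) (sq_nonneg x)]

lemma exp_log_sigmoid_sub (x : ℝ) :
    rexp (log (sigmoid (2 * π * x)) - π * x) = 1 / (2 * cosh (π * x)) := by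
  rw [exp_sub, exp_log (sigmoid_pos _), sigmoid_def, cosh_eq,
    show -(2 * π * x) = -(π * x) + -(π * x) by ring, exp_add, exp_neg]
  field_simp

lemma log_one_sub_sigmoid (t : ℝ) : log (1 - sigmoid t) = log (sigmoid t) - t := by
  rw [← sigmoid_neg, ← sigmoid_mul_rexp_neg, log_mul (sigmoid_pos t).ne' (exp_ne_zero _), log_exp]
  ring

lemma betaIntegral_one_half_sub (w : ℝ) :
    Complex.betaIntegral (1 / 2 - Complex.I * w) (1 / 2 + Complex.I * w) =
      π * 𝓕 (fun x : ℝ => ((1 / cosh (π * x) : ℝ) : ℂ)) w := by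
  have hinj : Set.InjOn (fun x : ℝ => sigmoid (2 * π * x)) Set.univ := by
    intro x _ y _ h
    have := sigmoid_injective h
    have := pi_pos.ne'
    simp_all
  have himg : (fun x : ℝ => sigmoid (2 * π * x)) '' Set.univ = Set.Ioo 0 1 := by
    rw [Set.image_univ, ← range_sigmoid]
    exact (mul_left_surjective₀ (by positivity : 2 * π ≠ 0)).range_comp sigmoid
  have hder : ∀ x ∈ (Set.univ : Set ℝ), HasDerivWithinAt (fun x : ℝ => sigmoid (2 * π * x))
      (2 * π * (sigmoid (2 * π * x) * (1 - sigmoid (2 * π * x)))) Set.univ x := by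
    intro x _
    have := (hasDerivAt_sigmoid (2 * π * x)).comp x ((hasDerivAt_id x).const_mul (2 * π))
    refine (this.congr_deriv ?_).hasDerivWithinAt
    ring
  rw [Complex.betaIntegral, intervalIntegral.integral_of_le zero_le_one,
    integral_Ioc_eq_integral_Ioo, ← himg,
    integral_image_eq_integral_abs_deriv_smul MeasurableSet.univ hder hinj,
    fourier_real_eq_integral_exp_smul, ← integral_const_mul, setIntegral_univ]
  congr 1 with x
  have h0 := sigmoid_pos (2 * π * x)
  have h1 : 0 < 1 - sigmoid (2 * π * x) := sub_pos.2 (sigmoid_lt_one _)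
  have hc := exp_log_sigmoid_sub x
  have hl := log_one_sub_sigmoid (2 * π * x)
  rw [abs_of_pos (by positivity), show 1 / cosh (π * x) = 2 * (1 / (2 * cosh (π * x))) by
    field_simp, ← hc]
  nth_rw 1 [← exp_log h0, ← exp_log h1]
  rw [hl, ← Complex.ofReal_one, ← Complex.ofReal_sub,
    Complex.cpow_def_of_ne_zero (by exact_mod_cast h0.ne'),
    Complex.cpow_def_of_ne_zero (by exact_mod_cast h1.ne'),
    ← Complex.ofReal_log h0.le, ← Complex.ofReal_log h1.le, hl]
  generalize log (sigmoid (2 * π * x)) = L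
  simp only [Complex.real_smul, smul_eq_mul]
  push_cast
  rw [show ∀ a b c d e : ℂ, 2 * a * (Complex.exp b * Complex.exp c) * (Complex.exp d * Complex.exp e)
    = 2 * a * Complex.exp (b + c + d + e) by intros; simp only [Complex.exp_add]; ring,
    show ∀ a b c : ℂ, a * (Complex.exp b * (2 * Complex.exp c)) = 2 * a * Complex.exp (b + c) by
      intros; simp only [Complex.exp_add]; ring]
  congr 2
  ring

lemma fourier_inv_cosh_pi_mul (w : ℝ) :
    𝓕 (fun x : ℝ => ((1 / cosh (π * x) : ℝ) : ℂ)) w = ((1 / cosh (π * w) : ℝ) : ℂ) := by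
  have h1 := betaIntegral_one_half_sub w
  have h2 := Complex.Gamma_mul_Gamma_eq_betaIntegral
    (s := 1 / 2 - Complex.I * w) (t := 1 / 2 + Complex.I * w) (by simp) (by simp)
  have h3 := Complex.Gamma_mul_Gamma_one_sub (1 / 2 - Complex.I * w)
  rw [show (1 : ℂ) - (1 / 2 - Complex.I * w) = 1 / 2 + Complex.I * w by ring, h2, h1,
    show (1 / 2 - Complex.I * w) + (1 / 2 + Complex.I * w) = 1 by ring, Complex.Gamma_one, one_mul,
    show (π : ℂ) * (1 / 2 - Complex.I * w) = π / 2 - (π * w) * Complex.I by ring,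
    Complex.sin_pi_div_two_sub, Complex.cos_mul_I, div_eq_mul_one_div] at h3
  have := mul_left_cancel₀ (by exact_mod_cast pi_ne_zero) h3
  rw [this]
  push_cast
  rfl

lemma integral_gaussian_div_cosh_inv {a : ℝ} (ha : 0 < a) :
    ∫ x : ℝ, rexp (-π * a * x ^ 2) / cosh (π * x) =
      a ^ (-(1 / 2) : ℝ) * ∫ x : ℝ, rexp (-π * a⁻¹ * x ^ 2) / cosh (π * x) := by
  have hg : Integrable fun x : ℝ => Complex.exp (-π * a * x ^ 2) := by
    have := (integrable_exp_neg_mul_sq (mul_pos pi_pos ha)).ofReal (𝕜 := ℂ)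
    refine this.congr (ae_of_all _ fun x => ?_)
    simp
  have h := VectorFourier.integral_fourierIntegral_smul_eq_flip (L := innerₗ ℝ) (μ := volume)
    (ν := volume) Real.continuous_fourierChar continuous_inner hg
    (integrable_inv_cosh_pi_mul.ofReal (𝕜 := ℂ))
  rw [flip_innerₗ] at h
  change ∫ w, 𝓕 (fun x : ℝ => Complex.exp (-π * a * x ^ 2)) w •
    ((1 / cosh (π * w) : ℝ) : ℂ) = ∫ x : ℝ, Complex.exp (-π * a * x ^ 2) •
      𝓕 (fun x : ℝ => ((1 / cosh (π * x) : ℝ) : ℂ)) x at h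
  rw [fourier_gaussian_pi (by simpa)] at h
  simp only [fourier_inv_cosh_pi_mul, smul_eq_mul] at h
  apply Complex.ofReal_injective
  rw [Complex.ofReal_mul, ← integral_complex_ofReal, ← integral_complex_ofReal,
    ← integral_const_mul]
  convert h.symm using 1
  · congr 1 with x
    push_cast
    ring
  · congr 1 with x
    rw [Complex.ofReal_cpow ha.le]
    push_cast
    rw [Complex.cpow_neg]
    ring_nf

lemma hasDerivAt_integral_gaussian_div_cosh {a : ℝ} (ha : 0 < a) :
    Integrable (fun x : ℝ => rexp (-π * a * x ^ 2) * (x ^ 2 / cosh (π * x))) ∧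
    HasDerivAt (fun a => ∫ x : ℝ, rexp (-π * a * x ^ 2) / cosh (π * x))
      (-π * ∫ x : ℝ, rexp (-π * a * x ^ 2) * (x ^ 2 / cosh (π * x))) a := by
  have key := hasDerivAt_integral_of_dominated_loc_of_deriv_le (μ := volume)
    (F := fun a x : ℝ => rexp (-π * a * x ^ 2) / cosh (π * x))
    (F' := fun a x : ℝ => -π * (rexp (-π * a * x ^ 2) * (x ^ 2 / cosh (π * x))))
    (bound := fun x => 2 / a * (1 / cosh (π * x))) (Ioi_mem_nhds (half_lt_self ha))
    (.of_forall fun b => Measurable.aestronglyMeasurable (by fun_prop)) ?_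
      (Measurable.aestronglyMeasurable (by fun_prop)) (ae_of_all _ fun x b hb => ?_)
    (integrable_inv_cosh_pi_mul.const_mul _) (ae_of_all _ fun x b _ => ?_)
  · rw [integral_const_mul] at key
    refine ⟨(key.1.const_mul (-π)⁻¹).congr (ae_of_all _ fun x => ?_), key.2⟩
    exact inv_mul_cancel_left₀ (neg_ne_zero.2 pi_ne_zero) _
  · refine integrable_inv_cosh_pi_mul.mono' (Measurable.aestronglyMeasurable (by fun_prop))
      (ae_of_all _ fun x => ?_)
    rw [norm_of_nonneg (by positivity)]
    gcongr
    rw [exp_le_one_iff]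
    nlinarith [mul_nonneg (mul_pos pi_pos ha).le (sq_nonneg x)]
  · have hb : a / 2 < b := hb
    have hb0 : 0 < b := (half_pos ha).trans hb
    have h1 : π * b * x ^ 2 * rexp (-π * b * x ^ 2) ≤ 1 := by
      rw [show -π * b * x ^ 2 = -(π * b * x ^ 2) by ring, exp_neg, ← div_eq_mul_inv,
        div_le_one (exp_pos _)]
      linarith [add_one_le_exp (π * b * x ^ 2)]
    have h2 : π * x ^ 2 * rexp (-π * b * x ^ 2) ≤ 2 / a := by
      rw [le_div_iff₀ ha]
      have : 0 ≤ π * x ^ 2 * rexp (-π * b * x ^ 2) := by positivity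
      nlinarith
    rw [neg_mul, norm_neg, norm_of_nonneg (by positivity)]
    calc _ = π * x ^ 2 * rexp (-π * b * x ^ 2) * (1 / cosh (π * x)) := by ring
      _ ≤ _ := by gcongr
  · have := ((((hasDerivAt_id b).const_mul (-π)).mul_const (x ^ 2)).exp).div_const (cosh (π * x))
    refine this.congr_deriv ?_
    simp only [id]
    ring

lemma integral_sq_mul_gaussian_div_cosh_add_inv {a : ℝ} (ha : 0 < a) :
    π * (∫ x : ℝ, rexp (-π * a * x ^ 2) * (x ^ 2 / cosh (π * x))) +
      π * a ^ (-(5 / 2) : ℝ) * (∫ x : ℝ, rexp (-π * a⁻¹ * x ^ 2) * (x ^ 2 / cosh (π * x))) =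
      (2 * a)⁻¹ * ∫ x : ℝ, rexp (-π * a * x ^ 2) / cosh (π * x) := by
  have hd := (hasDerivAt_integral_gaussian_div_cosh ha).2
  have hd' := ((hasDerivAt_id a).rpow_const (p := -(1 / 2)) (.inl ha.ne')).mul
    ((hasDerivAt_integral_gaussian_div_cosh (inv_pos.2 ha)).2.comp a (hasDerivAt_inv ha.ne'))
  have heq := hd.unique (hd'.congr_of_eventuallyEq <|
    (eventually_gt_nhds ha).mono fun b hb => integral_gaussian_div_cosh_inv hb)
  have h1 : a ^ (-(1 / 2) - 1 : ℝ) = a ^ (-(1 / 2) : ℝ) * a⁻¹ := by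
    rw [rpow_sub_one ha.ne', div_eq_mul_inv]
  have h2 : a ^ (-(5 / 2) : ℝ) = a ^ (-(1 / 2) : ℝ) * (a ^ 2)⁻¹ := by
    rw [show (-(5 / 2) : ℝ) = -(1 / 2) - (2 : ℕ) by norm_num, rpow_sub_natCast ha.ne',
      div_eq_mul_inv]
  simp only [id, Function.comp_apply, h1] at heq
  rw [integral_gaussian_div_cosh_inv ha, h2, mul_inv]
  linear_combination -heq

lemma catalan_pos : 0 < ∑' k : ℕ, (-1 : ℝ) ^ k / (2 * k + 1) ^ 2 := by
  have hs : Summable fun k : ℕ => (-1 : ℝ) ^ k / (2 * k + 1) ^ 2 := by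
    have h := (summable_nat_add_iff 1).2 (summable_one_div_nat_pow (p := 2).2 one_lt_two)
    refine h.of_norm_bounded fun k => ?_
    rw [norm_div, norm_pow, norm_neg, norm_one, one_pow, norm_of_nonneg (by positivity)]
    push_cast
    gcongr
    linarith [k.cast_nonneg (α := ℝ)]
  have h := Antitone.alternating_series_le_tendsto (f := fun k : ℕ => 1 / (2 * (k : ℝ) + 1) ^ 2)
    (by simpa only [mul_one_div] using hs.hasSum.tendsto_sum_nat)
    (fun i j hij => by dsimp only; gcongr) 1
  refine lt_of_lt_of_le ?_ h
  norm_num [Finset.sum_range_succ]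

theorem russell_integral_9 (G : ℝ)
    (hG : G = ∑' k : ℕ, (-1 : ℝ)^k / (2 * k + 1)^2) :
    ∫ x in Set.Ioi (0:ℝ),
      (π^5 * Real.exp (-π^3 * x^2 / G) + G ^ ((5:ℝ)/2) * Real.exp (-G * x^2 / π)) *
        (x^2 / Real.cosh (π * x)) =
    (π * G ^ ((3:ℝ)/2) / 2) *
      ∫ x in Set.Ioi (0:ℝ), Real.exp (-G * x^2 / π) / Real.cosh (π * x) := by
  have hG0 : 0 < G := hG ▸ catalan_pos
  have ha : 0 < G / π ^ 2 := by positivity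
  have hcosh (x : ℝ) : cosh (π * |x|) = cosh (π * x) := by
    rw [← cosh_abs (π * x), abs_mul, abs_of_pos pi_pos]
  have e1 (x : ℝ) : -π ^ 3 * x ^ 2 / G = -π * (G / π ^ 2)⁻¹ * x ^ 2 := by field_simp
  have e2 (x : ℝ) : -G * x ^ 2 / π = -π * (G / π ^ 2) * x ^ 2 := by field_simp
  have key := integral_sq_mul_gaussian_div_cosh_add_inv ha
  have hpow : (G / π ^ 2) ^ (-(5 / 2) : ℝ) = π ^ 5 / G ^ ((5 : ℝ) / 2) := by
    rw [rpow_neg ha.le, div_rpow hG0.le (by positivity), ← rpow_natCast, ← rpow_mul pi_pos.le,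
      inv_div]
    norm_num
  have hpow' : G ^ ((5 : ℝ) / 2) = G ^ ((3 : ℝ) / 2) * G := by
    rw [← rpow_add_one hG0.ne']
    norm_num
  refine mul_left_cancel₀ (two_ne_zero (α := ℝ)) ?_
  rw [← integral_comp_abs, mul_left_comm, ← integral_comp_abs]
  simp only [sq_abs, hcosh, e1, e2, add_mul, mul_assoc (π ^ 5), mul_assoc (G ^ ((5 : ℝ) / 2))]
  rw [integral_add
    ((hasDerivAt_integral_gaussian_div_cosh (inv_pos.2 ha)).1.const_mul _)
    ((hasDerivAt_integral_gaussian_div_cosh ha).1.const_mul _), integral_const_mul,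
    integral_const_mul]
  rw [hpow] at key
  generalize (∫ x : ℝ, rexp (-π * (G / π ^ 2) * x ^ 2) * (x ^ 2 / cosh (π * x))) = A at *
  generalize (∫ x : ℝ, rexp (-π * (G / π ^ 2)⁻¹ * x ^ 2) * (x ^ 2 / cosh (π * x))) = B at *
  generalize (∫ x : ℝ, rexp (-π * (G / π ^ 2) * x ^ 2) / cosh (π * x)) = C at *
  have hp : 0 < G ^ ((3 : ℝ) / 2) := by positivity
  rw [hpow'] at key ⊢
  generalize G ^ ((3 : ℝ) / 2) = t at *
  field_simp at key ⊢
  linear_combination key
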